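/- If G is a finite König–Egerváry graph, then diadem(G) = corona(G), i.e., the union of all critical independent sets equals the union of all maximum independent sets. -/

import Mathlib

open Finset

open scoped Classical

variable {V : Type*} [Fintype V] [DecidableEq V]

/-- The neighborhood `N(X)` of a finite set of vertices `X`. -/
noncomputable def nbr (G : SimpleGraph V) (X : Finset V) : Finset V :=
  Finset.univ.filter fun v => ∃ x ∈ X, G.Adj v x

/-- The difference `d(X) = |X| - |N(X)|` of a set of vertices. -/
noncomputable def diffZ (G : SimpleGraph V) (X : Finset V) : ℤ :=
  (X.card : ℤ) - ((nbr G X).card : ℤ)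

/-- The critical difference `d_c(G) = max {d(X) : X ⊆ V}`. -/
noncomputable def critDiff (G : SimpleGraph V) : ℤ :=
  (Finset.univ : Finset V).powerset.sup' (Finset.powerset_nonempty _) (diffZ G)

/-- A set of vertices is independent if no two of its vertices are adjacent. -/
def IsIndep (G : SimpleGraph V) (S : Finset V) : Prop :=
  ∀ u ∈ S, ∀ v ∈ S, ¬ G.Adj u v

/-- The independence number `α(G)`. -/
noncomputable def indepNum (G : SimpleGraph V) : ℕ :=
  ((Finset.univ : Finset V).powerset.filter (IsIndep G)).sup Finset.card

/-- The critical independence difference `id_c(G) = max {d(I) : I independent}`. -/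
noncomputable def idc (G : SimpleGraph V) : ℤ :=
  ((Finset.univ : Finset V).powerset.filter (IsIndep G)).sup'
    ⟨∅, by simp [IsIndep]⟩ (diffZ G)

/-- A critical independent set: an independent set `S` with `d(S) = id_c(G)`. -/
def CritIndep (G : SimpleGraph V) (S : Finset V) : Prop :=
  IsIndep G S ∧ diffZ G S = idc G

/-- A finite set of edges of `G` that are pairwise non-incident (a matching). -/
def IsMatchingSet (G : SimpleGraph V) (M : Finset (Sym2 V)) : Prop :=
  (∀ e ∈ M, e ∈ G.edgeSet) ∧
    (M : Set (Sym2 V)).Pairwise fun e f => ∀ v : V, ¬(v ∈ e ∧ v ∈ f)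

/-- The matching number `μ(G)`. -/
noncomputable def matchNum (G : SimpleGraph V) : ℕ :=
  ((Finset.univ : Finset (Sym2 V)).powerset.filter (IsMatchingSet G)).sup Finset.card

/-- A maximum independent set. -/
def IsMaxIndep (G : SimpleGraph V) (S : Finset V) : Prop :=
  IsIndep G S ∧ S.card = indepNum G

/-- `ker(G)`: the intersection of all critical independent sets. -/
noncomputable def kerSet (G : SimpleGraph V) : Finset V :=
  Finset.univ.filter fun v => ∀ S : Finset V, CritIndep G S → v ∈ S

/-- `diadem(G)`: the union of all critical independent sets. -/
noncomputable def diademSet (G : SimpleGraph V) : Finset V :=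
  Finset.univ.filter fun v => ∃ S : Finset V, CritIndep G S ∧ v ∈ S

/-- `core(G)`: the intersection of all maximum independent sets. -/
noncomputable def coreSet (G : SimpleGraph V) : Finset V :=
  Finset.univ.filter fun v => ∀ S : Finset V, IsMaxIndep G S → v ∈ S

/-- `corona(G)`: the union of all maximum independent sets. -/
noncomputable def coronaSet (G : SimpleGraph V) : Finset V :=
  Finset.univ.filter fun v => ∃ S : Finset V, IsMaxIndep G S ∧ v ∈ S

/-- `δ₀(A) = max {δ(X) : X ⊆ A}`, the maximum deficiency over subsets of a side. -/
noncomputable def delta0 (G : SimpleGraph V) (A : Finset V) : ℤ :=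
  A.powerset.sup' (Finset.powerset_nonempty _) (diffZ G)

/-- An `A`-critical set: a subset `X ⊆ A` with `δ(X) = δ₀(A)`. -/
def SideCrit (G : SimpleGraph V) (A X : Finset V) : Prop :=
  X ⊆ A ∧ diffZ G X = delta0 G A

/-- `ker_A(G)`: the intersection of all `A`-critical sets. -/
noncomputable def kerSide (G : SimpleGraph V) (A : Finset V) : Finset V :=
  Finset.univ.filter fun v => ∀ X : Finset V, SideCrit G A X → v ∈ X

/-- `diadem_A(G)`: the union of all `A`-critical sets. -/
noncomputable def diademSide (G : SimpleGraph V) (A : Finset V) : Finset V :=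
  Finset.univ.filter fun v => ∃ X : Finset V, SideCrit G A X ∧ v ∈ X

/-- `{A, B}` is a bipartition of `G`: both sides nonempty, disjoint, covering all
vertices, and every edge goes between `A` and `B`. -/
def IsBipartition (G : SimpleGraph V) (A B : Finset V) : Prop :=
  A.Nonempty ∧ B.Nonempty ∧ Disjoint A B ∧ A ∪ B = Finset.univ ∧
    ∀ u v : V, G.Adj u v → (u ∈ A ∧ v ∈ B) ∨ (u ∈ B ∧ v ∈ A)

lemma mem_nbr {G : SimpleGraph V} {X : Finset V} {v : V} :
    v ∈ nbr G X ↔ ∃ x ∈ X, G.Adj v x := by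
  simp [nbr]

lemma IsIndep.card_le_indepNum {G : SimpleGraph V} {S : Finset V} (hS : IsIndep G S) :
    S.card ≤ indepNum G :=
  Finset.le_sup (f := Finset.card) (by simpa using hS)

lemma exists_isMaxIndep (G : SimpleGraph V) : ∃ S, IsMaxIndep G S := by
  obtain ⟨S, hS, h⟩ := Finset.exists_mem_eq_sup
    ((Finset.univ : Finset V).powerset.filter (IsIndep G)) ⟨∅, by simp [IsIndep]⟩ Finset.card
  exact ⟨S, (Finset.mem_filter.1 hS).2, h.symm⟩

lemma exists_isMatchingSet_card_eq (G : SimpleGraph V) :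
    ∃ M, IsMatchingSet G M ∧ M.card = matchNum G := by
  obtain ⟨M, hM, h⟩ := Finset.exists_mem_eq_sup
    ((Finset.univ : Finset (Sym2 V)).powerset.filter (IsMatchingSet G))
    ⟨∅, by simp [IsMatchingSet]⟩ Finset.card
  exact ⟨M, (Finset.mem_filter.1 hM).2, h.symm⟩

/-- A set of vertices meets each edge in at most as many vertices as its neighborhood does. -/
lemma card_inter_edge_le {G : SimpleGraph V} (X : Finset V) {e : Sym2 V} (he : e ∈ G.edgeSet) :
    (X ∩ e.toFinset).card ≤ (nbr G X ∩ e.toFinset).card := by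
  induction e using Sym2.ind with
  | _ a b =>
    have hab : G.Adj a b := he
    refine Finset.card_le_card_of_injOn (Equiv.swap a b) ?_ (Equiv.swap a b).injective.injOn
    intro v hv
    simp only [Finset.coe_inter, Set.mem_inter_iff, Finset.mem_coe, Sym2.mem_toFinset,
      Sym2.mem_iff, mem_nbr] at hv ⊢
    obtain ⟨hv, rfl | rfl⟩ := hv
    · exact ⟨⟨v, hv, by simpa using hab.symm⟩, by simp⟩
    · exact ⟨⟨v, hv, by simpa using hab⟩, by simp⟩

/-- A matching bounds the difference of any set by the number of vertices it leaves uncovered. -/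
lemma IsMatchingSet.diffZ_le {G : SimpleGraph V} {M : Finset (Sym2 V)} (hM : IsMatchingSet G M)
    (X : Finset V) : diffZ G X ≤ (Fintype.card V : ℤ) - 2 * M.card := by
  set C := M.biUnion Sym2.toFinset with hC
  have hdisj : (M : Set (Sym2 V)).PairwiseDisjoint Sym2.toFinset := by
    intro e he f hf hef
    refine Finset.disjoint_left.2 fun v hve hvf => hM.2 he hf hef v ⟨?_, ?_⟩
    · simpa using hve
    · simpa using hvf
  have hCcard : C.card = 2 * M.card := by
    rw [hC, Finset.card_biUnion hdisj, Finset.sum_const_nat (m := 2), mul_comm]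
    exact fun e he => Sym2.card_toFinset_of_not_isDiag e (G.not_isDiag_of_mem_edgeSet (hM.1 e he))
  have hinter (Y : Finset V) : (Y ∩ C).card = ∑ e ∈ M, (Y ∩ e.toFinset).card := by
    rw [hC, Finset.inter_biUnion, Finset.card_biUnion]
    exact fun e he f hf hef => (hdisj he hf hef).mono Finset.inter_subset_right
      Finset.inter_subset_right
  have hle : (X ∩ C).card ≤ (nbr G X ∩ C).card := by
    rw [hinter, hinter]
    exact Finset.sum_le_sum fun e he => card_inter_edge_le X (hM.1 e he)
  have hN : (nbr G X ∩ C).card ≤ (nbr G X).card := Finset.card_le_card Finset.inter_subset_left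
  have hX := Finset.card_sdiff_add_card_inter X C
  have hXC : (X \ C).card ≤ Cᶜ.card := Finset.card_le_card fun v hv => by simp_all
  have hCc := Finset.card_add_card_compl C
  unfold diffZ
  omega

lemma diffZ_le_of_koenigEgervary {G : SimpleGraph V}
    (hke : indepNum G + matchNum G = Fintype.card V) (X : Finset V) :
    diffZ G X ≤ (indepNum G : ℤ) - matchNum G := by
  obtain ⟨M, hM, hcard⟩ := exists_isMatchingSet_card_eq G
  have := hM.diffZ_le X
  omega

lemma IsMaxIndep.diffZ_eq {G : SimpleGraph V} (hke : indepNum G + matchNum G = Fintype.card V)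
    {S : Finset V} (hS : IsMaxIndep G S) : diffZ G S = (indepNum G : ℤ) - matchNum G := by
  refine le_antisymm (diffZ_le_of_koenigEgervary hke S) ?_
  have hN : (nbr G S).card ≤ Sᶜ.card := Finset.card_le_card fun v hv => by
    obtain ⟨x, hx, hadj⟩ := mem_nbr.1 hv
    exact Finset.mem_compl.2 fun hvS => hS.1 v hvS x hx hadj
  have hSc := Finset.card_add_card_compl S
  have := hS.2
  unfold diffZ
  omega

lemma idc_eq_of_koenigEgervary {G : SimpleGraph V}
    (hke : indepNum G + matchNum G = Fintype.card V) :
    idc G = (indepNum G : ℤ) - matchNum G := by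
  obtain ⟨S, hS⟩ := exists_isMaxIndep G
  refine le_antisymm (Finset.sup'_le _ _ fun X _ => diffZ_le_of_koenigEgervary hke X) ?_
  rw [← hS.diffZ_eq hke]
  exact Finset.le_sup' (diffZ G) (by simpa using hS.1)

lemma IsMaxIndep.critIndep {G : SimpleGraph V} (hke : indepNum G + matchNum G = Fintype.card V)
    {S : Finset V} (hS : IsMaxIndep G S) : CritIndep G S :=
  ⟨hS.1, (hS.diffZ_eq hke).trans (idc_eq_of_koenigEgervary hke).symm⟩

/-- Replacing the neighbors of `X` in `S` by `X` keeps the set independent. -/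
lemma IsIndep.union_sdiff_nbr {G : SimpleGraph V} {X S : Finset V} (hX : IsIndep G X)
    (hS : IsIndep G S) : IsIndep G (X ∪ S \ nbr G X) := by
  intro u hu v hv hadj
  simp only [Finset.mem_union, Finset.mem_sdiff, mem_nbr] at hu hv
  rcases hu with hu | ⟨hu, hu'⟩ <;> rcases hv with hv | ⟨hv, hv'⟩
  · exact hX u hu v hv hadj
  · exact hv' ⟨u, hu, hadj.symm⟩
  · exact hu' ⟨v, hv, hadj⟩
  · exact hS u hu v hv hadj

lemma CritIndep.exists_isMaxIndep_superset {G : SimpleGraph V}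
    (hke : indepNum G + matchNum G = Fintype.card V) {X : Finset V} (hX : CritIndep G X) :
    ∃ S, IsMaxIndep G S ∧ X ⊆ S := by
  obtain ⟨S, hS⟩ := exists_isMaxIndep G
  have hind := hX.1.union_sdiff_nbr hS.1
  refine ⟨X ∪ S \ nbr G X, ⟨hind, le_antisymm hind.card_le_indepNum ?_⟩,
    Finset.subset_union_left⟩
  have hcrit := hX.2.trans (idc_eq_of_koenigEgervary hke)
  have hXS := diffZ_le_of_koenigEgervary hke (X ∩ S)
  have hN : (nbr G (X ∩ S)).card ≤ (nbr G X \ S).card := Finset.card_le_card fun v hv => by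
    obtain ⟨x, hx, hadj⟩ := mem_nbr.1 hv
    obtain ⟨hxX, hxS⟩ := Finset.mem_inter.1 hx
    exact Finset.mem_sdiff.2 ⟨mem_nbr.2 ⟨x, hxX, hadj⟩, fun hvS => hS.1 v hvS x hxS hadj⟩
  have hcover : S ∪ X \ S ⊆ (X ∪ S \ nbr G X) ∪ (nbr G X ∩ S) := fun v hv => by
    simp only [Finset.mem_union, Finset.mem_sdiff, Finset.mem_inter] at hv ⊢
    tauto
  have hcard := (Finset.card_le_card hcover).trans (Finset.card_union_le _ _)
  rw [Finset.card_union_of_disjoint Finset.disjoint_sdiff] at hcard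
  have hXcard := Finset.card_sdiff_add_card_inter X S
  have hNcard := Finset.card_sdiff_add_card_inter (nbr G X) S
  have := hS.2
  unfold diffZ at hcrit hXS
  omega

/-- If `G` is a finite König–Egerváry graph, then `diadem(G) = corona(G)`. -/
theorem diademSet_eq_coronaSet (G : SimpleGraph V)
    (hke : indepNum G + matchNum G = Fintype.card V) :
    diademSet G = coronaSet G := by
  ext v
  simp only [diademSet, coronaSet, Finset.mem_filter, Finset.mem_univ, true_and]
  constructor
  · rintro ⟨X, hX, hv⟩
    obtain ⟨S, hS, hXS⟩ := hX.exists_isMaxIndep_superset hke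
    exact ⟨S, hS, hXS hv⟩
  · rintro ⟨S, hS, hv⟩
    exact ⟨S, hS.critIndep hke, hv⟩
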